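/- arXiv:0806.1276 — 3 statements merged into one kernel-verified Lean document; each statement's English description precedes it below -/
import Mathlib

section
/- Let μ be a Borel probability measure on ℝ^d and assume s := inf_{q∈ℝ} B_μ(q) < 0. Let η > 0. For z > s put ψ(z) = inf{q ∈ ℝ : B_μ(q) < z}. Then inf{ψ(ηt) + t : s/η < t < 0} = (1/η) · inf_{q ≥ 1} (ηq + B_μ(q)) (when s = −∞ the condition on t is simply t < 0). -/
open Filter Set Metric MeasureTheory Topology ENNReal

noncomputable section

variable {X : Type*} [MetricSpace X] [MeasurableSpace X]

/-- The (topological) support of a Borel measure. -/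
def msupp (μ : Measure X) : Set X := {x | ∀ r > 0, 0 < μ (ball x r)}

/-- `(B(x i, r i))_{i ∈ I}` is a centered `ε`-packing of `E` : the centers lie in `E`,
the radii are positive and at most `ε`, and the closed balls are pairwise disjoint. -/
def IsCPacking (E : Set X) (ε : ℝ) (I : Set ℕ) (x : ℕ → X) (r : ℕ → ℝ) : Prop :=
  (∀ i ∈ I, x i ∈ E ∧ 0 < r i ∧ r i ≤ ε) ∧
  I.PairwiseDisjoint (fun i => closedBall (x i) (r i))

/-- The sum `Σ_i μ(B(x_i,r_i))^q (2 r_i)^t` associated to a packing.  Note that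
`ENNReal.rpow` satisfies exactly the conventions `0^q = ∞` for `q < 0` and `0^0 = 1`. -/
def packSum (μ : Measure X) (q t : ℝ) (I : Set ℕ) (x : ℕ → X) (r : ℕ → ℝ) : ℝ≥0∞ :=
  ∑' i : I, μ (closedBall (x i.1) (r i.1)) ^ q * ENNReal.ofReal (2 * r i.1) ^ t

/-- `P̄^{q,t}_{μ,ε}(E)`. -/
def prePackPre (μ : Measure X) (q t ε : ℝ) (E : Set X) : ℝ≥0∞ :=
  ⨆ (I : Set ℕ) (x : ℕ → X) (r : ℕ → ℝ) (_ : IsCPacking E ε I x r), packSum μ q t I x r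

/-- The prepacking measure `P̄^{q,t}_μ(E) = lim_{ε→0} P̄^{q,t}_{μ,ε}(E)`;
since `ε ↦ P̄^{q,t}_{μ,ε}(E)` is monotone, the limit is the infimum over `ε > 0`. -/
def prePack (μ : Measure X) (q t : ℝ) (E : Set X) : ℝ≥0∞ :=
  ⨅ (ε : ℝ) (_ : 0 < ε), prePackPre μ q t ε E

/-- The packing measure `P^{q,t}_μ(E)`, obtained from `P̄^{q,t}_μ` by countable covers. -/
def packMeas (μ : Measure X) (q t : ℝ) (E : Set X) : ℝ≥0∞ :=
  ⨅ (F : ℕ → Set X) (_ : E ⊆ ⋃ i, F i), ∑' i, prePack μ q t (F i)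

/-- The prepacking dimension `Δ^q_μ(E) = inf {t : P̄^{q,t}_μ(E) = 0}` (`+∞` if no such `t`). -/
def mfDelta (μ : Measure X) (q : ℝ) (E : Set X) : EReal :=
  ⨅ (t : ℝ) (_ : prePack μ q t E = 0), (t : EReal)

/-- The packing dimension `Dim^q_μ(E) = inf {t : P^{q,t}_μ(E) = 0}` (`+∞` if no such `t`). -/
def mfDim (μ : Measure X) (q : ℝ) (E : Set X) : EReal :=
  ⨅ (t : ℝ) (_ : packMeas μ q t E = 0), (t : EReal)

/-- `Dim(E) = Dim^0_μ(E)`, the packing dimension. -/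
def pDim (μ : Measure X) (E : Set X) : EReal := mfDim μ 0 E

/-- `Δ(E) = Δ^0_μ(E)`, the prepacking dimension. -/
def pDelta (μ : Measure X) (E : Set X) : EReal := mfDelta μ 0 E

/-- `B_μ(q) = Dim^q_μ(supp μ)`. -/
def Bmu (μ : Measure X) (q : ℝ) : EReal := mfDim μ q (msupp μ)

/-- `Λ_μ(q) = Δ^q_μ(supp μ)`. -/
def Lammu (μ : Measure X) (q : ℝ) : EReal := mfDelta μ q (msupp μ)

/-- `X̄^α = {x ∈ supp μ : limsup_{r→0} log μ(B(x,r)) / log r ≤ α}`. -/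
def Xbar (μ : Measure X) (α : ℝ) : Set X :=
  {x ∈ msupp μ |
    limsup (fun r => Real.log (μ (closedBall x r)).toReal / Real.log r) (𝓝[>] (0:ℝ)) ≤ α}

/-- `X_α(η,p) = {x ∈ X̄^α : ∀ r > 0, 2r ≥ 1/p or (2r)^η ≤ μ(B(x,r))}`. -/
def Xae (μ : Measure X) (α η : ℝ) (p : ℕ) : Set X :=
  {x ∈ Xbar μ α |
    ∀ r : ℝ, 0 < r →
      (1 : ℝ) / (p : ℝ) ≤ 2 * r ∨ ENNReal.ofReal ((2 * r) ^ η) ≤ μ (closedBall x r)}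

/-- Property `P_k` : the family `(B(y i, δ i))_{i ∈ I}` splits into at most `k` parts,
each of which is a centered `uε`-packing of `M`. -/
def HasPk (M : Set X) (uε : ℝ) (k : ℕ) (I : Set ℕ) (y : ℕ → X) (δ : ℕ → ℝ) : Prop :=
  ∃ c : ℕ → Fin k, ∀ j : Fin k, IsCPacking M uε {i ∈ I | c i = j} y δ

/-- `L^k_{ε,(B(x_i,r_i))}(M)` : infimum over families with property `P_k` of
`sup_{i∈I} log μ(B(y_i,δ_i)) / log (2 r_i)`. -/
def Lpack (μ : Measure X) (u : ℝ → ℝ) (k : ℕ) (ε : ℝ) (M : Set X)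
    (I : Set ℕ) (x : ℕ → X) (r : ℕ → ℝ) : EReal :=
  ⨅ (y : ℕ → X) (δ : ℕ → ℝ) (_ : HasPk M (u ε) k I y δ),
    ⨆ i : I,
      ((Real.log (μ (closedBall (y i.1) (δ i.1))).toReal / Real.log (2 * r i.1) : ℝ) : EReal)

/-- `L^k_ε(M)` : supremum over all centered `ε`-packings of `M`. -/
def Leps (μ : Measure X) (u : ℝ → ℝ) (k : ℕ) (ε : ℝ) (M : Set X) : EReal :=
  ⨆ (I : Set ℕ) (x : ℕ → X) (r : ℕ → ℝ) (_ : IsCPacking M ε I x r),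
    Lpack μ u k ε M I x r

/-- `L^k(M) = lim_{ε→0} L^k_ε(M)`; the function being monotone in `ε`,
the limit is the infimum over `ε > 0`. -/
def Lk (μ : Measure X) (u : ℝ → ℝ) (k : ℕ) (M : Set X) : EReal :=
  ⨅ (ε : ℝ) (_ : 0 < ε), Leps μ u k ε M

/-- `L(M) = lim_{k→∞} L^k(M)`; the sequence being nonincreasing, this is the infimum. -/
def Lfun (μ : Measure X) (u : ℝ → ℝ) (M : Set X) : EReal :=
  ⨅ (k : ℕ) (_ : 1 ≤ k), Lk μ u k M

/-- `T_μ(α,η,p) = sup {L(M) : M ⊆ X_α(η,p)}`. -/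
def Tp (μ : Measure X) (u : ℝ → ℝ) (α η : ℝ) (p : ℕ) : EReal :=
  ⨆ (M : Set X) (_ : M ⊆ Xae μ α η p), Lfun μ u M

/-- `T_μ(α,η) = lim_{p→∞} T_μ(α,η,p)`; the sequence being nondecreasing, this is the
supremum over `p ≥ 1`. -/
def Teta (μ : Measure X) (u : ℝ → ℝ) (α η : ℝ) : EReal :=
  ⨆ (p : ℕ) (_ : 1 ≤ p), Tp μ u α η p

/-- `T_μ(α) = lim_{η→α⁺} T_μ(α,η)`; the function being nondecreasing in `η`, this is the
infimum over `η > α`. -/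
def Tfun (μ : Measure X) (u : ℝ → ℝ) (α : ℝ) : EReal :=
  ⨅ (η : ℝ) (_ : α < η), Teta μ u α η

/-- `ψ(z) = inf B_μ⁻¹((-∞, z))`. -/
def psiB (μ : Measure X) (z : ℝ) : ℝ := sInf {q : ℝ | Bmu μ q < (z : EReal)}

/-- The sum of the measures of the balls of a packing is at most the total mass. -/
lemma tsum_measure_le_one_of_isCPacking [OpensMeasurableSpace X] (μ : Measure X)
    [IsProbabilityMeasure μ] {E : Set X} {ε : ℝ} {I : Set ℕ} {x : ℕ → X} {r : ℕ → ℝ}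
    (h : IsCPacking E ε I x r) : ∑' i : I, μ (closedBall (x i.1) (r i.1)) ≤ 1 := by
  rw [← measure_biUnion (Set.to_countable I) h.2 fun _ _ => isClosed_closedBall.measurableSet]
  exact prob_le_one

/-- Interpolation between the exponents `(1, 0)` and `(q₀, t₀)`. -/
lemma prePack_eq_zero_of_interpolation [OpensMeasurableSpace X] (μ : Measure X)
    [IsProbabilityMeasure μ] {q₀ t₀ θ t : ℝ} (hq₀ : 0 ≤ q₀) (hθ : 0 ≤ θ) (hθ1 : θ ≤ 1)
    (ht : θ * t₀ < t) {E : Set X} (hE : prePack μ q₀ t₀ E ≠ ∞) :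
    prePack μ (1 - θ + q₀ * θ) t E = 0 := by
  obtain ⟨ε₀, hε₀, hfin⟩ : ∃ ε₀ > 0, prePackPre μ q₀ t₀ ε₀ E < ∞ := by
    simpa [prePack, iInf_lt_iff] using hE.lt_top
  set C := prePackPre μ q₀ t₀ ε₀ E
  have hδ : 0 < t - θ * t₀ := by linarith
  have bound : ∀ ε : ℝ, 0 < ε → ε ≤ ε₀ →
      prePack μ (1 - θ + q₀ * θ) t E ≤ ENNReal.ofReal (2 * ε) ^ (t - θ * t₀) * (1 + C) := by
    intro ε hε hεε₀
    refine (iInf₂_le ε hε).trans ?_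
    refine iSup_le fun I => iSup_le fun x => iSup_le fun r => iSup_le fun hp => ?_
    have hp₀ : IsCPacking E ε₀ I x r :=
      ⟨fun i hi => ⟨(hp.1 i hi).1, (hp.1 i hi).2.1, (hp.1 i hi).2.2.trans hεε₀⟩, hp.2⟩
    have hC : packSum μ q₀ t₀ I x r ≤ C :=
      le_iSup_of_le I (le_iSup_of_le x (le_iSup_of_le r (le_iSup_of_le hp₀ le_rfl)))
    refine le_trans ?_ (mul_le_mul_right
      (add_le_add (tsum_measure_le_one_of_isCPacking μ hp) hC) _)
    rw [packSum, packSum, ← ENNReal.tsum_add, ← ENNReal.tsum_mul_left]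
    refine ENNReal.tsum_le_tsum fun i => ?_
    obtain ⟨-, hr, hrε⟩ := hp.1 i i.2
    set m := μ (closedBall (x i.1) (r i.1))
    set R := ENNReal.ofReal (2 * r i.1)
    have hR0 : R ≠ 0 := by simpa [R] using hr
    have hRt : R ≠ ∞ := ENNReal.ofReal_ne_top
    have hRε : R ≤ ENNReal.ofReal (2 * ε) := ENNReal.ofReal_le_ofReal (by linarith)
    have hsplit : m ^ (1 - θ + q₀ * θ) * R ^ t
        = R ^ (t - θ * t₀) * (m ^ (1 - θ) * (m ^ q₀ * R ^ t₀) ^ θ) := by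
      rw [ENNReal.mul_rpow_of_nonneg _ _ hθ, ← ENNReal.rpow_mul, ← ENNReal.rpow_mul,
        ENNReal.rpow_add_of_nonneg _ _ (by linarith) (by positivity),
        show t = (t - θ * t₀) + t₀ * θ by ring, ENNReal.rpow_add _ _ hR0 hRt]
      ring_nf
    rw [hsplit]
    refine mul_le_mul' (ENNReal.rpow_le_rpow hRε hδ.le) ?_
    set b := m ^ q₀ * R ^ t₀
    calc m ^ (1 - θ) * b ^ θ
        ≤ (m + b) ^ (1 - θ) * (m + b) ^ θ :=
          mul_le_mul' (ENNReal.rpow_le_rpow le_self_add (by linarith))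
            (ENNReal.rpow_le_rpow le_add_self hθ)
      _ = m + b := by
          rw [← ENNReal.rpow_add_of_nonneg _ _ (by linarith) hθ]; simp
  have hlim : Tendsto (fun ε : ℝ => ENNReal.ofReal (2 * ε) ^ (t - θ * t₀) * (1 + C))
      (𝓝[>] 0) (𝓝 0) := by
    have h1 : Tendsto (fun ε : ℝ => ENNReal.ofReal (2 * ε) ^ (t - θ * t₀)) (𝓝[>] 0) (𝓝 0) := by
      have : Continuous fun ε : ℝ => ENNReal.ofReal (2 * ε) ^ (t - θ * t₀) :=
        ENNReal.continuous_rpow_const.comp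
          (ENNReal.continuous_ofReal.comp (continuous_const.mul continuous_id))
      have h := (this.tendsto 0).mono_left (nhdsWithin_le_nhds (s := Ioi 0))
      simpa [ENNReal.zero_rpow_of_pos hδ] using h
    have := ENNReal.Tendsto.mul_const (b := 1 + C) h1
      (Or.inr (ENNReal.add_ne_top.2 ⟨ENNReal.one_ne_top, hfin.ne⟩))
    simpa using this
  refine le_antisymm (ge_of_tendsto hlim ?_) zero_le
  filter_upwards [Ioc_mem_nhdsGT hε₀] with ε hε using bound ε hε.1 hε.2

/-- If `B_μ` is negative at some `q₀ > 1`, it is negative at all interior points of `[1, q₀]`. -/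
lemma Bmu_neg_of_interpolation [OpensMeasurableSpace X] (μ : Measure X)
    [IsProbabilityMeasure μ] {q₀ θ : ℝ} (hq₀ : 0 ≤ q₀) (hθ : 0 < θ) (hθ1 : θ ≤ 1)
    (h : Bmu μ q₀ < 0) : Bmu μ (1 - θ + q₀ * θ) < 0 := by
  obtain ⟨t₀, hzero, ht₀⟩ : ∃ t₀ : ℝ, packMeas μ q₀ t₀ (msupp μ) = 0 ∧ t₀ < 0 := by
    simpa [Bmu, mfDim, iInf_lt_iff] using h
  obtain ⟨F, hF, hsum⟩ : ∃ F : ℕ → Set X, msupp μ ⊆ ⋃ i, F i ∧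
      ∑' i, prePack μ q₀ t₀ (F i) < ∞ := by
    have : packMeas μ q₀ t₀ (msupp μ) < ∞ := by simp [hzero]
    rw [packMeas] at this
    simpa only [iInf_lt_iff, exists_prop] using this
  have ht : θ * t₀ < θ * t₀ / 2 := by nlinarith
  have hnull : packMeas μ (1 - θ + q₀ * θ) (θ * t₀ / 2) (msupp μ) = 0 := by
    refine le_antisymm ((iInf₂_le F hF).trans (le_of_eq ?_)) zero_le
    exact ENNReal.tsum_eq_zero.2 fun i => prePack_eq_zero_of_interpolation μ hq₀ hθ.le hθ1 ht
      (ENNReal.ne_top_of_tsum_ne_top hsum.ne i)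
  refine (iInf₂_le (θ * t₀ / 2) hnull).trans_lt ?_
  exact_mod_cast (by nlinarith : θ * t₀ / 2 < 0)

/-- The support of a measure on a second countable space is conull. -/
lemma measure_compl_msupp [SecondCountableTopology X] (μ : Measure X) : μ (msupp μ)ᶜ = 0 := by
  refine measure_null_of_locally_null _ fun x hx => ?_
  obtain ⟨r, hr, h⟩ : ∃ r > 0, μ (ball x r) = 0 := by simpa [msupp] using hx
  exact ⟨ball x r, mem_nhdsWithin_of_mem_nhds (ball_mem_nhds x hr), h⟩

/-- By the Besicovitch covering theorem, `P̄^{q,t}_μ` dominates `μ` for `q ≤ 1` and `t ≤ 0`. -/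
lemma measure_le_prePack [SecondCountableTopology X] [HasBesicovitchCovering X]
    [OpensMeasurableSpace X] (μ : Measure X) [IsProbabilityMeasure μ] {q t : ℝ}
    (hq : q ≤ 1) (ht : t ≤ 0) (E : Set X) : μ E ≤ prePack μ q t E := by
  refine le_iInf₂ fun ε hε => ?_
  rcases E.eq_empty_or_nonempty with rfl | ⟨x₀, -⟩
  · simp
  have : Nonempty X := ⟨x₀⟩
  obtain ⟨T, r, hT, hTE, hr, hnull, hdisj⟩ := Besicovitch.exists_disjoint_closedBall_covering_ae μ
    (fun _ => Ioi (0 : ℝ)) E (fun x _ δ hδ => ⟨δ / 2, half_pos hδ, half_pos hδ, half_lt_self hδ⟩)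
    (fun _ => min ε (1 / 2)) (fun _ _ => by positivity)
  obtain ⟨f, hf⟩ := Set.countable_iff_exists_injOn.1 hT
  have hinv : ∀ a ∈ T, Function.invFunOn f T (f a) = a := fun a ha => hf.leftInvOn_invFunOn ha
  set g := Function.invFunOn f T
  have hpack : IsCPacking E ε (f '' T) g (r ∘ g) := by
    refine ⟨?_, ?_⟩
    · rintro _ ⟨a, ha, rfl⟩
      have h := (hr a ha).2
      simp only [Function.comp_apply, hinv a ha]
      exact ⟨hTE ha, h.1, (h.2.trans_le (min_le_left _ _)).le⟩
    · rintro _ ⟨a, ha, rfl⟩ _ ⟨b, hb, rfl⟩ hab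
      simp only [Function.onFun, Function.comp_apply, hinv a ha, hinv b hb]
      exact hdisj ha hb fun h => hab (h ▸ rfl)
  have hsum : packSum μ q t (f '' T) g (r ∘ g)
      = ∑' a : T, μ (closedBall a.1 (r a)) ^ q * ENNReal.ofReal (2 * r a) ^ t := by
    rw [packSum, tsum_image (fun i => μ (closedBall (g i) ((r ∘ g) i)) ^ q *
      ENNReal.ofReal (2 * (r ∘ g) i) ^ t) hf]
    refine tsum_congr fun a => ?_
    simp only [Function.comp_apply, hinv a a.2]
  calc μ E ≤ μ (⋃ a ∈ T, closedBall a (r a)) := by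
        refine (measure_le_inter_add_sdiff μ E (⋃ a ∈ T, closedBall a (r a))).trans ?_
        rw [hnull, add_zero]
        exact measure_mono inter_subset_right
    _ ≤ ∑' a : T, μ (closedBall a.1 (r a)) := measure_biUnion_le μ hT _
    _ ≤ packSum μ q t (f '' T) g (r ∘ g) := by
        rw [hsum]
        refine ENNReal.tsum_le_tsum fun a => ?_
        have h := (hr a a.2).2
        have hsmall : ENNReal.ofReal (2 * r a) ≤ 1 := by
          have := h.2.trans_le (min_le_right _ _)
          exact ENNReal.ofReal_le_one.2 (by linarith)
        calc μ (closedBall a.1 (r a)) = μ (closedBall a.1 (r a)) ^ (1 : ℝ) * 1 := by simp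
          _ ≤ _ := mul_le_mul' (ENNReal.rpow_le_rpow_of_exponent_ge prob_le_one hq)
              (by simpa using ENNReal.rpow_le_rpow_of_exponent_ge hsmall ht)
    _ ≤ prePackPre μ q t ε E :=
        le_iSup_of_le _ (le_iSup_of_le _ (le_iSup_of_le _ (le_iSup_of_le hpack le_rfl)))

lemma Bmu_nonneg [SecondCountableTopology X] [HasBesicovitchCovering X] [OpensMeasurableSpace X]
    (μ : Measure X) [IsProbabilityMeasure μ] {q : ℝ} (hq : q ≤ 1) : 0 ≤ Bmu μ q := by
  refine le_iInf₂ fun t ht => ?_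
  by_contra! hneg
  have hneg' : t ≤ 0 := by exact_mod_cast hneg.le
  have hle : μ (msupp μ) ≤ packMeas μ q t (msupp μ) :=
    le_iInf₂ fun F hF => (measure_mono hF).trans <| (measure_iUnion_le F).trans <|
      ENNReal.tsum_le_tsum fun i => measure_le_prePack μ hq hneg' (F i)
  rw [ht, nonpos_iff_eq_zero] at hle
  have huniv := measure_union_null hle (measure_compl_msupp μ)
  simp at huniv

lemma one_lt_of_Bmu_neg [SecondCountableTopology X] [HasBesicovitchCovering X]
    [OpensMeasurableSpace X] (μ : Measure X) [IsProbabilityMeasure μ] {q : ℝ}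
    (hq : Bmu μ q < 0) : 1 < q := by
  by_contra! h
  exact hq.not_ge (Bmu_nonneg μ h)

/-- `B_μ` takes negative values arbitrarily close to `1` on the right if it is somewhere
negative. -/
lemma exists_lt_one_add_Bmu_neg [SecondCountableTopology X] [HasBesicovitchCovering X]
    [OpensMeasurableSpace X] (μ : Measure X) [IsProbabilityMeasure μ]
    (hs : (⨅ q : ℝ, Bmu μ q) < 0) {ε : ℝ} (hε : 0 < ε) : ∃ q < 1 + ε, Bmu μ q < 0 := by
  obtain ⟨q₀, hq₀⟩ := iInf_lt_iff.1 hs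
  have h1 := one_lt_of_Bmu_neg μ hq₀
  have hpos : 0 < q₀ - 1 + ε := by linarith
  set θ := ε / (q₀ - 1 + ε)
  have hθ : 0 < θ := by positivity
  have hθ1 : θ < 1 := (div_lt_one hpos).2 (by linarith)
  refine ⟨_, ?_, Bmu_neg_of_interpolation μ (by linarith) hθ hθ1.le hq₀⟩
  have : θ * (q₀ - 1 + ε) = ε := div_mul_cancel₀ _ hpos.ne'
  nlinarith

lemma bddBelow_setOf_Bmu_lt [SecondCountableTopology X] [HasBesicovitchCovering X]
    [OpensMeasurableSpace X] (μ : Measure X) [IsProbabilityMeasure μ] {z : ℝ} (hz : z < 0) :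
    BddBelow {q : ℝ | Bmu μ q < (z : EReal)} :=
  ⟨1, fun _ hq => (one_lt_of_Bmu_neg μ (lt_trans hq (by exact_mod_cast hz))).le⟩

/-- **Proposition 3.** For `s = inf_q B_μ(q) < 0` and `η > 0`,
`inf {ψ(ηt) + t : s/η < t < 0} = (1/η) · inf_{q ≥ 1} (ηq + B_μ(q))`
(the condition `s/η < t` being expressed as `s < ηt`; when `s = -∞` it is vacuous). -/
theorem inf_psi_eq (d : ℕ) (μ : Measure (EuclideanSpace ℝ (Fin d)))
    [IsProbabilityMeasure μ]
    (η : ℝ) (hη : 0 < η) (hs : (⨅ q : ℝ, Bmu μ q) < 0) :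
    (⨅ (t : ℝ) (_ : (⨅ q : ℝ, Bmu μ q) < ((η * t : ℝ) : EReal) ∧ t < 0),
        ((psiB μ (η * t) + t : ℝ) : EReal)) =
      ((1 / η : ℝ) : EReal) *
        ⨅ (q : ℝ) (_ : 1 ≤ q), (((η * q : ℝ) : EReal) + Bmu μ q) := by
  set L := ⨅ (t : ℝ) (_ : (⨅ q : ℝ, Bmu μ q) < ((η * t : ℝ) : EReal) ∧ t < 0),
        ((psiB μ (η * t) + t : ℝ) : EReal)
  have hneg : ∀ (q z : ℝ), z < 0 → Bmu μ q < (z : EReal) → L ≤ ((q + z / η : ℝ) : EReal) := by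
    intro q z hz hqz
    have hz' : η * (z / η) = z := mul_div_cancel₀ z hη.ne'
    have hlt : (⨅ q : ℝ, Bmu μ q) < ((η * (z / η) : ℝ) : EReal) := by
      rw [hz']
      exact (iInf_le _ q).trans_lt hqz
    refine (iInf₂_le (z / η) ⟨hlt, div_neg_of_neg_of_pos hz hη⟩).trans ?_
    rw [hz', EReal.coe_le_coe_iff]
    gcongr
    exact csInf_le (bddBelow_setOf_Bmu_lt μ hz) hqz
  have hL1 : L ≤ ((1 : ℝ) : EReal) := by
    refine EReal.le_of_forall_lt_iff_le.1 fun c hc => ?_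
    have hc' : 1 < c := by exact_mod_cast hc
    obtain ⟨q, hqc, hq⟩ := exists_lt_one_add_Bmu_neg μ hs (sub_pos.2 hc')
    obtain ⟨z, hqz, hz⟩ := EReal.lt_iff_exists_real_btwn.1 hq
    have hz' : z < 0 := by exact_mod_cast hz
    refine (hneg q z hz' hqz).trans ?_
    rw [EReal.coe_le_coe_iff]
    have := div_neg_of_neg_of_pos hz' hη
    linarith
  have hle : ∀ (q z : ℝ), 1 ≤ q → Bmu μ q < (z : EReal) → L ≤ ((q + z / η : ℝ) : EReal) := by
    intro q z hq hqz
    rcases lt_or_ge z 0 with hz | hz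
    · exact hneg q z hz hqz
    · refine hL1.trans (EReal.coe_le_coe_iff.2 ?_)
      have : 0 ≤ z / η := by positivity
      linarith
  have hη' : (0 : EReal) < (η : EReal) := by exact_mod_cast hη
  set R := ⨅ (q : ℝ) (_ : 1 ≤ q), (((η * q : ℝ) : EReal) + Bmu μ q)
  have hdiv : ((1 / η : ℝ) : EReal) * R = R / (η : EReal) := by
    rw [EReal.div_eq_inv_mul, one_div, EReal.coe_inv]
  rw [hdiv]
  refine le_antisymm ?_ (le_iInf₂ fun t ht => ?_)
  · rw [EReal.le_div_iff_mul_le hη' (EReal.coe_ne_top η)]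
    refine le_iInf₂ fun q hq => ?_
    rw [add_comm, ← EReal.sub_le_iff_le_add (Or.inl (EReal.coe_ne_bot _)) (Or.inl (EReal.coe_ne_top _))]
    refine EReal.le_of_forall_lt_iff_le.1 fun z hz => ?_
    rw [EReal.sub_le_iff_le_add (Or.inl (EReal.coe_ne_bot _)) (Or.inl (EReal.coe_ne_top _)),
      ← EReal.le_div_iff_mul_le hη' (EReal.coe_ne_top η)]
    refine (hle q z hq hz).trans (le_of_eq ?_)
    rw [← EReal.coe_add, ← EReal.coe_div, EReal.coe_eq_coe_iff]
    field_simp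
    ring
  · obtain ⟨hst, ht0⟩ := ht
    have hz : η * t < 0 := mul_neg_of_pos_of_neg hη ht0
    refine EReal.le_of_forall_lt_iff_le.1 fun c hc => ?_
    have hc' : psiB μ (η * t) < c - t := by
      have : psiB μ (η * t) + t < c := by exact_mod_cast hc
      linarith
    obtain ⟨q, hq, hqc⟩ := exists_lt_of_csInf_lt (iInf_lt_iff.1 hst) hc'
    have hq1 : 1 ≤ q := (one_lt_of_Bmu_neg μ (lt_trans hq (by exact_mod_cast hz))).le
    rw [EReal.div_le_iff_le_mul hη' (EReal.coe_ne_top η)]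
    refine (iInf₂_le q hq1).trans ((add_le_add le_rfl (le_of_lt hq)).trans ?_)
    rw [← EReal.coe_add, ← EReal.coe_mul, EReal.coe_le_coe_iff]
    nlinarith

end
end

section
/- Let μ be a Borel probability measure on ℝ^d and α > 0. Then T_μ(α) ≤ α; equivalently (1/α) · T_μ(α) ≤ 1. -/
open Filter Set Metric MeasureTheory Topology ENNReal

noncomputable section

variable {X : Type*} [MetricSpace X] [MeasurableSpace X]

/-- A ball of mass at least `s ^ η` with `0 < s < 1` has logarithmic ratio at most `η`. -/
theorem log_toReal_div_log_le {m : ℝ≥0∞} (hm : m ≠ ∞) {s η : ℝ} (hs : 0 < s) (hs1 : s < 1)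
    (h : ENNReal.ofReal (s ^ η) ≤ m) : Real.log m.toReal / Real.log s ≤ η := by
  rw [div_le_iff_of_neg (Real.log_neg hs hs1), ← Real.log_rpow hs]
  exact Real.log_le_log (Real.rpow_pos_of_pos hs η) ((ENNReal.ofReal_le_iff_le_toReal hm).1 h)

/-- A packing, taken as its own companion family, bounds `L(M)` by `η` for `M ⊆ X_α(η,p)`. -/
theorem Lfun_le_of_subset_Xae {μ : Measure X} [IsFiniteMeasure μ] {u : ℝ → ℝ}
    (hu_ge : ∀ ε : ℝ, 0 < ε → ε ≤ u ε) {α η : ℝ} {p : ℕ} (hp : 1 ≤ p) {M : Set X}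
    (hM : M ⊆ Xae μ α η p) : Lfun μ u M ≤ (η : EReal) := by
  have hp0 : (1 : ℝ) ≤ p := by exact_mod_cast hp
  have hε : (0 : ℝ) < 1 / (4 * p) := by positivity
  refine (iInf₂_le 1 le_rfl).trans ((iInf₂_le _ hε).trans ?_)
  refine iSup_le fun I => iSup_le fun x => iSup_le fun r => iSup_le fun hpack => ?_
  have hPk : HasPk M (u (1 / (4 * p))) 1 I x r :=
    ⟨fun _ => 0, fun j =>
      ⟨fun i hi => ⟨(hpack.1 i hi.1).1, (hpack.1 i hi.1).2.1,
          (hpack.1 i hi.1).2.2.trans (hu_ge _ hε)⟩,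
        hpack.2.subset fun i hi => hi.1⟩⟩
  refine (iInf_le _ x).trans ((iInf_le _ r).trans ((iInf_le _ hPk).trans (iSup_le fun i => ?_)))
  obtain ⟨hx, hr, hrε⟩ := hpack.1 i.1 i.2
  have hsmall : 2 * r i.1 < 1 / (p : ℝ) := by
    have hquarter : (1 : ℝ) / (4 * p) = 1 / p / 4 := by field_simp
    have hpos : (0 : ℝ) < 1 / p := by positivity
    linarith
  have hone : (1 : ℝ) / p ≤ 1 := div_le_one_of_le₀ hp0 (by positivity)
  exact_mod_cast log_toReal_div_log_le (measure_ne_top μ _) (by positivity)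
    (hsmall.trans_le hone) (((hM hx).2 (r i.1) hr).resolve_left (not_le.2 hsmall))

/-- `T_μ(α) ≤ α`; equivalently `(1/α) · T_μ(α) ≤ 1`. -/
theorem Tfun_le_alpha (d : ℕ) (μ : Measure (EuclideanSpace ℝ (Fin d)))
    [IsProbabilityMeasure μ]
    (u : ℝ → ℝ) (hu_pos : ∀ ε : ℝ, 0 < ε → 0 < u ε) (hu_ge : ∀ ε : ℝ, 0 < ε → ε ≤ u ε)
    (hu_lim : Tendsto u (𝓝[>] (0:ℝ)) (𝓝 0))
    (α : ℝ) (hα : 0 < α) :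
    Tfun μ u α ≤ (α : EReal) ∧ ((1 / α : ℝ) : EReal) * Tfun μ u α ≤ 1 := by
  have hT : Tfun μ u α ≤ (α : EReal) := by
    refine EReal.le_of_forall_lt_iff_le.1 fun η hη => ?_
    refine (iInf₂_le η (EReal.coe_lt_coe_iff.1 hη)).trans ?_
    exact iSup₂_le fun p hp => iSup₂_le fun M hM => Lfun_le_of_subset_Xae hu_ge hp hM
  refine ⟨hT, ?_⟩
  calc ((1 / α : ℝ) : EReal) * Tfun μ u α ≤ ((1 / α : ℝ) : EReal) * (α : EReal) :=
        mul_le_mul_of_nonneg_left hT (by exact_mod_cast (one_div_pos.2 hα).le)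
    _ = 1 := by rw [← EReal.coe_mul, one_div_mul_cancel hα.ne', EReal.coe_one]

end
end

section
/- Let μ be a Borel probability measure on ℝ^d. Then the functions q ↦ Λ_μ(q) and q ↦ B_μ(q) are convex and nonincreasing on ℝ. -/
open Filter Set Metric MeasureTheory Topology ENNReal

noncomputable section

variable {X : Type*} [MetricSpace X] [MeasurableSpace X]

theorem IsCPacking.mono {Y : Type*} [MetricSpace Y] {E F : Set Y} {ε ε' : ℝ} {I : Set ℕ}
    {x : ℕ → Y} {r : ℕ → ℝ} (h : IsCPacking E ε I x r) (hE : E ⊆ F) (hε : ε ≤ ε') :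
    IsCPacking F ε' I x r :=
  ⟨fun i hi => ⟨hE (h.1 i hi).1, (h.1 i hi).2.1, (h.1 i hi).2.2.trans hε⟩, h.2⟩

section Monotonicity

variable {μ : Measure X} {q t ε : ℝ} {E F : Set X}

theorem packSum_le_prePackPre {I : Set ℕ} {x : ℕ → X} {r : ℕ → ℝ} (h : IsCPacking E ε I x r) :
    packSum μ q t I x r ≤ prePackPre μ q t ε E :=
  le_iSup_of_le I <| le_iSup_of_le x <| le_iSup_of_le r <| le_iSup_of_le h le_rfl

theorem prePackPre_le {c : ℝ≥0∞}
    (h : ∀ I x r, IsCPacking E ε I x r → packSum μ q t I x r ≤ c) :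
    prePackPre μ q t ε E ≤ c :=
  iSup_le fun I => iSup_le fun x => iSup_le fun r => iSup_le fun hp => h I x r hp

theorem prePack_le_prePackPre (hε : 0 < ε) : prePack μ q t E ≤ prePackPre μ q t ε E :=
  iInf₂_le ε hε

theorem prePackPre_mono {ε' : ℝ} (hE : E ⊆ F) (hε : ε ≤ ε') :
    prePackPre μ q t ε E ≤ prePackPre μ q t ε' F :=
  prePackPre_le fun _ _ _ h => packSum_le_prePackPre (h.mono hE hε)

theorem prePack_mono (hE : E ⊆ F) : prePack μ q t E ≤ prePack μ q t F :=
  iInf₂_mono fun _ _ => prePackPre_mono hE le_rfl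

theorem prePack_anti_exponent [IsProbabilityMeasure μ] {q' : ℝ} (h : q ≤ q') :
    prePack μ q' t E ≤ prePack μ q t E := by
  refine iInf₂_mono fun ε _ => prePackPre_le fun I x r hp =>
    le_trans ?_ (packSum_le_prePackPre hp)
  refine ENNReal.tsum_le_tsum fun i => ?_
  gcongr ?_ * _
  exact ENNReal.rpow_le_rpow_of_exponent_ge prob_le_one h

theorem packMeas_anti_exponent [IsProbabilityMeasure μ] {q' : ℝ} (h : q ≤ q') :
    packMeas μ q' t E ≤ packMeas μ q t E :=
  iInf₂_mono fun _ _ => ENNReal.tsum_le_tsum fun _ => prePack_anti_exponent h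

theorem packMeas_eq_zero_of_cover {G : ℕ → Set X} (hG : E ⊆ ⋃ i, G i)
    (h : ∀ i, prePack μ q t (G i) = 0) : packMeas μ q t E = 0 := by
  refine le_antisymm ((iInf₂_le G hG).trans ?_) bot_le
  simp [h]

theorem mfDim_le_mfDelta : mfDim μ q E ≤ mfDelta μ q E :=
  le_iInf₂ fun t ht => iInf₂_le t <|
    packMeas_eq_zero_of_cover (G := fun _ => E) (by simp [iUnion_const]) fun _ => ht

theorem mfDelta_antitone [IsProbabilityMeasure μ] : Antitone fun q => mfDelta μ q E :=
  fun _ _ h => le_iInf₂ fun t ht => iInf₂_le (f := fun (t : ℝ) _ => (t : EReal)) t <|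
    le_antisymm ((prePack_anti_exponent h).trans ht.le) bot_le

theorem mfDim_antitone [IsProbabilityMeasure μ] : Antitone fun q => mfDim μ q E :=
  fun _ _ h => le_iInf₂ fun t ht => iInf₂_le (f := fun (t : ℝ) _ => (t : EReal)) t <|
    le_antisymm ((packMeas_anti_exponent h).trans ht.le) bot_le

end Monotonicity

section ExponentGap

variable {μ : Measure X} {q t t' : ℝ} {E : Set X}

theorem prePackPre_le_rpow_mul {ε : ℝ} (h : t ≤ t') :
    prePackPre μ q t' ε E ≤ ENNReal.ofReal (2 * ε) ^ (t' - t) * prePackPre μ q t ε E := by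
  refine prePackPre_le fun I x r hp => ?_
  refine le_trans ?_ (mul_le_mul_right (packSum_le_prePackPre hp) _)
  rw [packSum, packSum, ← ENNReal.tsum_mul_left]
  refine ENNReal.tsum_le_tsum fun i => ?_
  obtain ⟨-, hr, hrε⟩ := hp.1 i i.2
  have hpos : ENNReal.ofReal (2 * r i) ≠ 0 := by simpa using hr
  have hsplit : ENNReal.ofReal (2 * r i) ^ t' =
      ENNReal.ofReal (2 * r i) ^ (t' - t) * ENNReal.ofReal (2 * r i) ^ t := by
    rw [← ENNReal.rpow_add _ _ hpos ENNReal.ofReal_ne_top, sub_add_cancel]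
  rw [hsplit, mul_left_comm]
  gcongr

theorem prePack_eq_zero_of_lt (ht : t < t') (h : prePack μ q t E ≠ ∞) :
    prePack μ q t' E = 0 := by
  obtain ⟨ε₀, hε₀, hfin⟩ : ∃ ε₀ : ℝ, 0 < ε₀ ∧ prePackPre μ q t ε₀ E < ∞ := by
    simpa [prePack, iInf_lt_iff] using lt_top_iff_ne_top.2 h
  have hlim : Tendsto
      (fun ε : ℝ => ENNReal.ofReal (2 * ε) ^ (t' - t) * prePackPre μ q t ε₀ E)
      (𝓝[>] 0) (𝓝 0) := by
    have h1 : Tendsto (fun ε : ℝ => ENNReal.ofReal (2 * ε) ^ (t' - t)) (𝓝 0) (𝓝 0) := by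
      have hc : Continuous fun ε : ℝ => ENNReal.ofReal (2 * ε) ^ (t' - t) :=
        ENNReal.continuous_rpow_const.comp (ENNReal.continuous_ofReal.comp (by fun_prop))
      simpa [ENNReal.zero_rpow_of_pos (sub_pos.2 ht)] using hc.tendsto 0
    simpa using ENNReal.Tendsto.mul_const (h1.mono_left nhdsWithin_le_nhds)
      (Or.inr hfin.ne)
  refine le_antisymm (ge_of_tendsto hlim ?_) bot_le
  filter_upwards [Ioc_mem_nhdsGT hε₀] with ε hε
  refine (prePack_le_prePackPre hε.1).trans ((prePackPre_le_rpow_mul ht.le).trans ?_)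
  gcongr
  exact prePackPre_mono subset_rfl hε.2

theorem exists_cover_prePack_eq_zero (ht : t < t') (h : packMeas μ q t E = 0) :
    ∃ G : ℕ → Set X, E ⊆ ⋃ i, G i ∧ ∀ i, prePack μ q t' (G i) = 0 := by
  obtain ⟨G, hG, hlt⟩ : ∃ G : ℕ → Set X, E ⊆ ⋃ i, G i ∧ ∑' i, prePack μ q t (G i) < ∞ := by
    have : packMeas μ q t E < ∞ := by simp [h]
    simpa only [packMeas, iInf_lt_iff, exists_prop] using this
  exact ⟨G, hG, fun i => prePack_eq_zero_of_lt ht (ENNReal.ne_top_of_tsum_ne_top hlt.ne i)⟩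

end ExponentGap

section Convexity

theorem ENNReal.rpow_mul_rpow_le_add {a b : ℝ} (ha : 0 ≤ a) (hb : 0 ≤ b) (hab : a + b = 1)
    (x y : ℝ≥0∞) : x ^ a * y ^ b ≤ x + y := calc
  x ^ a * y ^ b ≤ (x + y) ^ a * (x + y) ^ b := by
    gcongr
    · exact le_self_add
    · exact le_add_self
  _ = x + y := by rw [← ENNReal.rpow_add_of_nonneg _ _ ha hb, hab, ENNReal.rpow_one]

variable {μ : Measure X} {a b q₁ q₂ t₁ t₂ : ℝ} {E : Set X}

theorem measure_closedBall_pos_of_mem_msupp {x : X} (hx : x ∈ msupp μ) {r : ℝ} (hr : 0 < r) :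
    0 < μ (closedBall x r) :=
  (hx r hr).trans_le (measure_mono ball_subset_closedBall)

theorem prePackPre_convexComb_le [IsFiniteMeasure μ] {ε : ℝ} (ha : 0 ≤ a) (hb : 0 ≤ b)
    (hab : a + b = 1) (hE : E ⊆ msupp μ) :
    prePackPre μ (a * q₁ + b * q₂) (a * t₁ + b * t₂) ε E ≤
      prePackPre μ q₁ t₁ ε E + prePackPre μ q₂ t₂ ε E := by
  refine prePackPre_le fun I x r hp => ?_
  refine le_trans ?_ (add_le_add (packSum_le_prePackPre hp) (packSum_le_prePackPre hp))
  rw [packSum, packSum, packSum, ← ENNReal.tsum_add]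
  refine ENNReal.tsum_le_tsum fun i => ?_
  obtain ⟨hx, hr, -⟩ := hp.1 i i.2
  have hm := (measure_closedBall_pos_of_mem_msupp (hE hx) hr).ne'
  have hr' : ENNReal.ofReal (2 * r i) ≠ 0 := by simpa using hr
  refine le_trans (le_of_eq ?_) (ENNReal.rpow_mul_rpow_le_add ha hb hab _ _)
  rw [ENNReal.rpow_add _ _ hm (measure_ne_top _ _),
    ENNReal.rpow_add _ _ hr' ENNReal.ofReal_ne_top,
    ENNReal.mul_rpow_of_nonneg _ _ ha, ENNReal.mul_rpow_of_nonneg _ _ hb,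
    ← ENNReal.rpow_mul, ← ENNReal.rpow_mul, ← ENNReal.rpow_mul, ← ENNReal.rpow_mul,
    mul_comm q₁, mul_comm q₂, mul_comm t₁, mul_comm t₂, mul_mul_mul_comm]

theorem prePack_convexComb_eq_zero [IsFiniteMeasure μ] (ha : 0 ≤ a) (hb : 0 ≤ b)
    (hab : a + b = 1) (hE : E ⊆ msupp μ) (h₁ : prePack μ q₁ t₁ E = 0)
    (h₂ : prePack μ q₂ t₂ E = 0) :
    prePack μ (a * q₁ + b * q₂) (a * t₁ + b * t₂) E = 0 := by
  refine le_antisymm (ENNReal.le_of_forall_pos_le_add fun δ hδ _ => ?_) bot_le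
  have hδ' : (0 : ℝ≥0∞) < (δ : ℝ≥0∞) / 2 := by simpa using hδ.ne'
  have key : ∀ q t : ℝ, prePack μ q t E = 0 →
      ∃ ε : ℝ, 0 < ε ∧ prePackPre μ q t ε E < (δ : ℝ≥0∞) / 2 := by
    intro q t h
    rw [← h] at hδ'
    simpa only [prePack, iInf_lt_iff, exists_prop] using hδ'
  obtain ⟨ε₁, hε₁, hlt₁⟩ := key _ _ h₁
  obtain ⟨ε₂, hε₂, hlt₂⟩ := key _ _ h₂
  calc prePack μ (a * q₁ + b * q₂) (a * t₁ + b * t₂) E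
      ≤ prePackPre μ q₁ t₁ (min ε₁ ε₂) E + prePackPre μ q₂ t₂ (min ε₁ ε₂) E :=
        (prePack_le_prePackPre (lt_min hε₁ hε₂)).trans (prePackPre_convexComb_le ha hb hab hE)
    _ ≤ (δ : ℝ≥0∞) / 2 + (δ : ℝ≥0∞) / 2 :=
        add_le_add ((prePackPre_mono subset_rfl (min_le_left _ _)).trans hlt₁.le)
          ((prePackPre_mono subset_rfl (min_le_right _ _)).trans hlt₂.le)
    _ = 0 + δ := by rw [ENNReal.add_halves, zero_add]

theorem packMeas_convexComb_eq_zero [IsFiniteMeasure μ] {s₁ s₂ : ℝ} (ha : 0 ≤ a) (hb : 0 ≤ b)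
    (hab : a + b = 1) (hE : E ⊆ msupp μ) (hs₁ : t₁ < s₁) (hs₂ : t₂ < s₂)
    (h₁ : packMeas μ q₁ t₁ E = 0) (h₂ : packMeas μ q₂ t₂ E = 0) :
    packMeas μ (a * q₁ + b * q₂) (a * s₁ + b * s₂) E = 0 := by
  obtain ⟨G, hG, hG0⟩ := exists_cover_prePack_eq_zero hs₁ h₁
  obtain ⟨H, hH, hH0⟩ := exists_cover_prePack_eq_zero hs₂ h₂
  refine packMeas_eq_zero_of_cover (G := fun n => E ∩ G n.unpair.1 ∩ H n.unpair.2) ?_ ?_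
  · intro x hx
    obtain ⟨i, hi⟩ := mem_iUnion.1 (hG hx)
    obtain ⟨j, hj⟩ := mem_iUnion.1 (hH hx)
    exact mem_iUnion.2 ⟨Nat.pair i j, by simp [hx, hi, hj]⟩
  · intro n
    refine prePack_convexComb_eq_zero ha hb hab (fun x hx => hE hx.1.1) ?_ ?_
    · exact le_antisymm ((prePack_mono fun x hx => hx.1.2).trans (hG0 _).le) bot_le
    · exact le_antisymm ((prePack_mono fun x hx => hx.2).trans (hH0 _).le) bot_le

theorem EReal.le_mul_add_mul_of_forall_lt {D D₁ D₂ : EReal} (ha : 0 < a) (hb : 0 < b)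
    (hab : a + b = 1) (h₁ : D₁ ≠ ⊥) (h₂ : D₂ ≠ ⊥)
    (h : ∀ s₁ s₂ : ℝ, D₁ < s₁ → D₂ < s₂ → D ≤ ((a * s₁ + b * s₂ : ℝ) : EReal)) :
    D ≤ (a : EReal) * D₁ + (b : EReal) * D₂ := by
  induction D₁ with
  | bot => exact absurd rfl h₁
  | top =>
    rw [EReal.coe_mul_top_of_pos ha, EReal.top_add_of_ne_bot]
    · exact le_top
    · induction D₂ with
      | bot => exact absurd rfl h₂
      | top => simp [EReal.coe_mul_top_of_pos hb]
      | coe y => exact_mod_cast EReal.coe_ne_bot (b * y)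
  | coe x =>
    induction D₂ with
    | bot => exact absurd rfl h₂
    | top =>
      rw [EReal.coe_mul_top_of_pos hb, ← EReal.coe_mul, EReal.coe_add_top]
      exact le_top
    | coe y =>
      rw [← EReal.coe_mul, ← EReal.coe_mul, ← EReal.coe_add]
      refine EReal.le_of_forall_lt_iff_le.1 fun z hz => ?_
      have hz' : a * x + b * y < z := by exact_mod_cast hz
      set δ := z - (a * x + b * y)
      have hδ : 0 < δ := _root_.sub_pos.2 hz'
      refine (h (x + δ) (y + δ) (by exact_mod_cast lt_add_of_pos_right x hδ)
        (by exact_mod_cast lt_add_of_pos_right y hδ)).trans (le_of_eq ?_)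
      congr 1
      calc a * (x + δ) + b * (y + δ) = a * x + b * y + (a + b) * δ := by ring
        _ = z := by rw [hab]; ring

/-- Convexity in `EReal`, where `⊥ + ⊤ = ⊥` forces the values `⊥` to be excluded. -/
theorem EReal.convex_of_forall_lt {f : ℝ → EReal} (hbot : ∀ q, f q ≠ ⊥)
    (h : ∀ a b q₁ q₂ s₁ s₂ : ℝ, 0 ≤ a → 0 ≤ b → a + b = 1 → f q₁ < s₁ → f q₂ < s₂ →
      f (a * q₁ + b * q₂) ≤ ((a * s₁ + b * s₂ : ℝ) : EReal))
    (a b q₁ q₂ : ℝ) (ha : 0 ≤ a) (hb : 0 ≤ b) (hab : a + b = 1) :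
    f (a * q₁ + b * q₂) ≤ (a : EReal) * f q₁ + (b : EReal) * f q₂ := by
  rcases ha.eq_or_lt with rfl | ha'
  · obtain rfl : b = 1 := by simpa using hab
    simp
  rcases hb.eq_or_lt with rfl | hb'
  · obtain rfl : a = 1 := by simpa using hab
    simp
  exact EReal.le_mul_add_mul_of_forall_lt ha' hb' hab (hbot _) (hbot _)
    fun s₁ s₂ => h a b q₁ q₂ s₁ s₂ ha hb hab

theorem mfDelta_convexComb_le [IsFiniteMeasure μ] {s₁ s₂ : ℝ} (ha : 0 ≤ a) (hb : 0 ≤ b)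
    (hab : a + b = 1) (hE : E ⊆ msupp μ) (h₁ : mfDelta μ q₁ E < s₁) (h₂ : mfDelta μ q₂ E < s₂) :
    mfDelta μ (a * q₁ + b * q₂) E ≤ ((a * s₁ + b * s₂ : ℝ) : EReal) := by
  simp only [mfDelta, iInf_lt_iff, exists_prop, EReal.coe_lt_coe_iff] at h₁ h₂
  obtain ⟨t₁, hz₁, ht₁⟩ := h₁
  obtain ⟨t₂, hz₂, ht₂⟩ := h₂
  exact iInf₂_le (f := fun (t : ℝ) _ => (t : EReal)) _ <| prePack_convexComb_eq_zero ha hb hab hE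
    (prePack_eq_zero_of_lt ht₁ (hz₁.trans_ne ENNReal.zero_ne_top)) (prePack_eq_zero_of_lt ht₂ (hz₂.trans_ne ENNReal.zero_ne_top))

theorem mfDim_convexComb_le [IsFiniteMeasure μ] {s₁ s₂ : ℝ} (ha : 0 ≤ a) (hb : 0 ≤ b)
    (hab : a + b = 1) (hE : E ⊆ msupp μ) (h₁ : mfDim μ q₁ E < s₁) (h₂ : mfDim μ q₂ E < s₂) :
    mfDim μ (a * q₁ + b * q₂) E ≤ ((a * s₁ + b * s₂ : ℝ) : EReal) := by
  simp only [mfDim, iInf_lt_iff, exists_prop, EReal.coe_lt_coe_iff] at h₁ h₂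
  obtain ⟨t₁, hz₁, ht₁⟩ := h₁
  obtain ⟨t₂, hz₂, ht₂⟩ := h₂
  exact iInf₂_le (f := fun (t : ℝ) _ => (t : EReal)) _ <| packMeas_convexComb_eq_zero ha hb hab hE ht₁ ht₂ hz₁ hz₂

end Convexity

section LowerBound

variable {d : ℕ} {μ : Measure (EuclideanSpace ℝ (Fin d))} [IsProbabilityMeasure μ]

theorem msupp_eq_support (μ : Measure X) : msupp μ = μ.support := by
  ext x
  rw [Measure.mem_support_iff_forall]
  refine ⟨fun hx U hU => ?_, fun hx r hr => hx _ (ball_mem_nhds x hr)⟩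
  obtain ⟨r, hr, hrU⟩ := Metric.mem_nhds_iff.1 hU
  exact (hx r hr).trans_le (measure_mono hrU)

theorem measure_msupp_ne_zero : μ (msupp μ) ≠ 0 := by
  intro h
  have h' : μ (msupp μ)ᶜ = 0 := by rw [msupp_eq_support, Measure.measure_compl_support]
  have := measure_union_null h h'
  simp at this

/-- The upper local dimension of `μ` is at most `d` almost everywhere, in quantitative form. -/
theorem ae_exists_mul_rpow_le_measure_closedBall (μ : Measure (EuclideanSpace ℝ (Fin d)))
    [IsProbabilityMeasure μ] :
    ∀ᵐ x ∂μ, ∃ κ : ℝ≥0∞, κ ≠ 0 ∧ ∀ᶠ r : ℝ in 𝓝[>] 0,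
      κ * ENNReal.ofReal (2 * r) ^ (d : ℝ) ≤ μ (closedBall x r) := by
  filter_upwards [Besicovitch.ae_tendsto_rnDeriv volume μ, Measure.rnDeriv_lt_top volume μ]
    with x hx hfin
  set L := (volume : Measure (EuclideanSpace ℝ (Fin d))).rnDeriv μ x
  have hv : volume (ball (0 : EuclideanSpace ℝ (Fin d)) 1) ≠ 0 :=
    (measure_ball_pos _ _ one_pos).ne'
  have hC : L + 1 ≠ ∞ := by simp [hfin.ne]
  refine ⟨ENNReal.ofReal (1 / 2) ^ (d : ℝ) * volume (ball (0 : EuclideanSpace ℝ (Fin d)) 1)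
    / (L + 1), ?_, ?_⟩
  · refine (ENNReal.div_pos (mul_ne_zero ?_ hv) hC).ne'
    exact (ENNReal.rpow_pos (by simp) ENNReal.ofReal_ne_top).ne'
  have hlt : L < L + 1 := ENNReal.lt_add_right hfin.ne one_ne_zero
  filter_upwards [hx.eventually_lt_const hlt, self_mem_nhdsWithin] with r hr hr0
  have hr0 : 0 < r := hr0
  have hvol := (ENNReal.div_le_iff_le_mul (Or.inr hC) (Or.inr (by simp))).1 hr.le
  rw [Measure.addHaar_closedBall _ _ hr0.le, finrank_euclideanSpace_fin] at hvol
  have hscale : ENNReal.ofReal (1 / 2) ^ (d : ℝ) * ENNReal.ofReal (2 * r) ^ (d : ℝ) =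
      ENNReal.ofReal (r ^ d) := by
    rw [← ENNReal.mul_rpow_of_nonneg _ _ d.cast_nonneg, ← ENNReal.ofReal_mul (by norm_num),
      ENNReal.rpow_natCast, ← ENNReal.ofReal_pow (by positivity)]
    congr 2
    ring
  refine le_trans (le_of_eq ?_) (ENNReal.div_le_of_le_mul' hvol)
  simp only [← hscale, div_eq_mul_inv]
  ring

theorem one_le_rpow_of_le_one_of_nonpos {x : ℝ≥0∞} {z : ℝ} (hx : x ≤ 1) (hz : z ≤ 0) :
    1 ≤ x ^ z := by
  simpa using ENNReal.rpow_le_rpow_of_exponent_ge hx hz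

theorem measure_eq_zero_of_prePack_eq_zero {q t : ℝ} {F : Set (EuclideanSpace ℝ (Fin d))}
    (ht : t ≤ -(d * |q|)) (h : prePack μ q t F = 0) : μ F = 0 := by
  by_contra hF
  obtain ⟨x, hxF, κ, hκ, hx⟩ :=
    ((frequently_ae_mem_iff.2 hF).and_eventually
      (ae_exists_mul_rpow_le_measure_closedBall μ)).exists
  have ht0 : t ≤ 0 := ht.trans (by simp; positivity)
  have hlow : min 1 (κ ^ |q|) ≤ prePack μ q t F := by
    refine le_iInf₂ fun ε hε => ?_
    obtain ⟨r, ⟨hκr, hr, hrmin⟩⟩ :=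
      (hx.and (Ioc_mem_nhdsGT (lt_min hε (one_half_pos (α := ℝ))))).exists
    have hr1 : ENNReal.ofReal (2 * r) ≤ 1 := by
      rw [ENNReal.ofReal_le_one]
      linarith [hrmin.trans (min_le_right _ _)]
    have hr0 : ENNReal.ofReal (2 * r) ≠ 0 := by simpa using hr
    have hp : IsCPacking F ε {0} (fun _ => x) (fun _ => r) :=
      ⟨fun i _ => ⟨hxF, hr, hrmin.trans (min_le_left _ _)⟩, pairwiseDisjoint_singleton _ _⟩
    refine le_trans ?_ (packSum_le_prePackPre hp)
    have hsum : packSum μ q t {0} (fun _ => x) (fun _ => r) =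
        μ (closedBall x r) ^ q * ENNReal.ofReal (2 * r) ^ t := by
      simp [packSum]
    rw [hsum]
    rcases le_total q 0 with hq | hq
    · refine (min_le_left _ _).trans ?_
      exact one_le_mul (one_le_rpow_of_le_one_of_nonpos prob_le_one hq)
        (one_le_rpow_of_le_one_of_nonpos hr1 ht0)
    · rw [abs_of_nonneg hq] at ht ⊢
      calc min 1 (κ ^ q) ≤ κ ^ q := min_le_right _ _
        _ = (κ * ENNReal.ofReal (2 * r) ^ (d : ℝ)) ^ q *
            ENNReal.ofReal (2 * r) ^ (-(d * q)) := by
          rw [ENNReal.mul_rpow_of_nonneg _ _ hq, ← ENNReal.rpow_mul, mul_assoc,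
            ← ENNReal.rpow_add _ _ hr0 ENNReal.ofReal_ne_top, add_neg_cancel,
            ENNReal.rpow_zero, mul_one]
        _ ≤ μ (closedBall x r) ^ q * ENNReal.ofReal (2 * r) ^ t := by
          gcongr ?_ * ?_
          · exact ENNReal.rpow_le_rpow hκr hq
          · exact ENNReal.rpow_le_rpow_of_exponent_ge hr1 ht
  rw [h] at hlow
  refine hlow.not_gt (lt_min one_pos (pos_iff_ne_zero.2 ?_))
  simp [ENNReal.rpow_eq_zero_iff, hκ, (abs_nonneg q).not_gt]

theorem mfDim_msupp_ne_bot (q : ℝ) : mfDim μ q (msupp μ) ≠ ⊥ := by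
  intro h
  have hlt : mfDim μ q (msupp μ) < ((-(d * |q|) : ℝ) : EReal) := by
    rw [h]
    exact EReal.bot_lt_coe _
  simp only [mfDim, iInf_lt_iff, exists_prop, EReal.coe_lt_coe_iff] at hlt
  obtain ⟨t, hz, ht⟩ := hlt
  obtain ⟨G, hG, hG0⟩ := exists_cover_prePack_eq_zero ht hz
  exact measure_msupp_ne_zero (μ := μ) <| measure_mono_null hG <|
    measure_iUnion_null fun i => measure_eq_zero_of_prePack_eq_zero le_rfl (hG0 i)

theorem mfDelta_msupp_ne_bot (q : ℝ) : mfDelta μ q (msupp μ) ≠ ⊥ :=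
  fun h => mfDim_msupp_ne_bot (μ := μ) q (le_bot_iff.1 (mfDim_le_mfDelta.trans h.le))

end LowerBound

/-- **Proposition 1.iii.** The functions `Λ_μ` and `B_μ` are convex and nonincreasing. -/
theorem Lammu_Bmu_convex_antitone (d : ℕ) (μ : Measure (EuclideanSpace ℝ (Fin d)))
    [IsProbabilityMeasure μ] :
    (∀ a b q₁ q₂ : ℝ, 0 ≤ a → 0 ≤ b → a + b = 1 →
      Lammu μ (a * q₁ + b * q₂) ≤ (a : EReal) * Lammu μ q₁ + (b : EReal) * Lammu μ q₂) ∧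
    Antitone (Lammu μ) ∧
    (∀ a b q₁ q₂ : ℝ, 0 ≤ a → 0 ≤ b → a + b = 1 →
      Bmu μ (a * q₁ + b * q₂) ≤ (a : EReal) * Bmu μ q₁ + (b : EReal) * Bmu μ q₂) ∧
    Antitone (Bmu μ) := by
  exact ⟨EReal.convex_of_forall_lt mfDelta_msupp_ne_bot fun _ _ _ _ _ _ ha hb hab =>
      mfDelta_convexComb_le ha hb hab subset_rfl,
    mfDelta_antitone,
    EReal.convex_of_forall_lt mfDim_msupp_ne_bot fun _ _ _ _ _ _ ha hb hab =>
      mfDim_convexComb_le ha hb hab subset_rfl,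
    mfDim_antitone⟩

end
end
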